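/- Let X be a compact metric space and f : X → X a continuous map. For every shadowable point x of f, the following are equivalent: (i) x is both an upper and a lower semicontinuity point of the ω-limit set map ω_f (i.e., a continuity point of ω_f with respect to the Hausdorff distance); (ii) ω_f(x) is chain stable and is a minimal set for f. -/

import Mathlib

open Filter Topology

variable {X : Type*} [MetricSpace X]

/-- The ω-limit set of `x` under `f`: points `y` with `f^[φ j] x → y` for some
strictly increasing sequence `φ`. -/
def omegaLimitPt (f : X → X) (x : X) : Set X :=
  {y | ∃ φ : ℕ → ℕ, StrictMono φ ∧ Tendsto (fun j => f^[φ j] x) atTop (𝓝 y)}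

/-- The set `Ω_f(x)`: points `y` such that there are `x_j → x` and a strictly
increasing sequence `φ` with `f^[φ j] (x_j) → y`. -/
def bigOmega (f : X → X) (x : X) : Set X :=
  {y | ∃ (xs : ℕ → X) (φ : ℕ → ℕ), StrictMono φ ∧
    Tendsto xs atTop (𝓝 x) ∧ Tendsto (fun j => f^[φ j] (xs j)) atTop (𝓝 y)}

/-- `x` is a shadowable point for `f`. -/
def ShadowablePoint (f : X → X) (x : X) : Prop :=
  ∀ ε > 0, ∃ δ > 0, ∀ xs : ℕ → X, (∀ i, dist (f (xs i)) (xs (i + 1)) ≤ δ) →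
    xs 0 = x → ∃ y, ∀ i, dist (xs i) (f^[i] y) ≤ ε

/-- `x` is an upper semicontinuity point of the ω-limit set map. -/
def USCPoint (f : X → X) (x : X) : Prop :=
  ∀ U : Set X, IsOpen U → omegaLimitPt f x ⊆ U →
    ∃ δ > 0, ∀ y, dist x y ≤ δ → omegaLimitPt f y ⊆ U

/-- `x` is a lower semicontinuity point of the ω-limit set map. -/
def LSCPoint (f : X → X) (x : X) : Prop :=
  ∀ U : Set X, IsOpen U → (omegaLimitPt f x ∩ U).Nonempty →
    ∃ δ > 0, ∀ y, dist x y ≤ δ → (omegaLimitPt f y ∩ U).Nonempty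

/-- `(c i)_{i=0}^k` is a `δ`-chain of `f` (with `k ≥ 1`). -/
def IsDeltaChain (f : X → X) (δ : ℝ) (c : ℕ → X) (k : ℕ) : Prop :=
  1 ≤ k ∧ ∀ i < k, dist (f (c i)) (c (i + 1)) ≤ δ

/-- `y → z`: for every `δ > 0` there is a `δ`-chain of `f` from `y` to `z`. -/
def ChainReach (f : X → X) (y z : X) : Prop :=
  ∀ δ > 0, ∃ (c : ℕ → X) (k : ℕ), IsDeltaChain f δ c k ∧ c 0 = y ∧ c k = z

/-- A set `S` is chain stable: `y ∈ S` and `y → z` imply `z ∈ S`. -/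
def ChainStable (f : X → X) (S : Set X) : Prop :=
  ∀ y ∈ S, ∀ z, ChainReach f y z → z ∈ S

/-- The set `ω_f*(x)`: points reachable from `x` by arbitrarily fine and
arbitrarily long `δ`-chains. -/
def omegaStar (f : X → X) (x : X) : Set X :=
  {y | ∀ δ > 0, ∀ l : ℕ, 1 ≤ l → ∃ (c : ℕ → X) (k : ℕ),
    l ≤ k ∧ IsDeltaChain f δ c k ∧ c 0 = x ∧ c k = y}

/-- The chain component of a point `p`. -/
def chainComponent (f : X → X) (p : X) : Set X :=
  {q | ChainReach f p q ∧ ChainReach f q p}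

/-- `f` is chain continuous at `x`. -/
def ChainContinuousAt (f : X → X) (x : X) : Prop :=
  ∀ ε > 0, ∃ δ > 0, ∀ xs : ℕ → X, (∀ i, dist (f (xs i)) (xs (i + 1)) ≤ δ) →
    xs 0 = x → ∀ i, dist (xs i) (f^[i] x) ≤ ε

/-- The chain recurrent set `CR(f)`. -/
def chainRecurrent (f : X → X) : Set X := {x | ChainReach f x x}

/-- `x` is a regularly recurrent point for `f`. -/
def RegularlyRecurrent (f : X → X) (x : X) : Prop :=
  ∀ ε > 0, ∃ k : ℕ, 1 ≤ k ∧ ∀ j : ℕ, dist x (f^[j * k] x) ≤ ε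

/-- `M` is a minimal set for `f`. -/
def IsMinimalSet (f : X → X) (M : Set X) : Prop :=
  M.Nonempty ∧ IsClosed M ∧ f '' M ⊆ M ∧ ∀ y ∈ M, omegaLimitPt f y = M

lemma mem_omegaLimitPt_iff {f : X → X} {x y : X} :
    y ∈ omegaLimitPt f x ↔ MapClusterPt y atTop (fun n => f^[n] x) := by
  constructor
  · rintro ⟨φ, hφ, h⟩
    exact MapClusterPt.of_comp hφ.tendsto_atTop h.mapClusterPt
  · intro h
    exact h.tendsto_subseq

lemma mapClusterPt_atTop_iff {u : ℕ → X} {y : X} :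
    MapClusterPt y atTop u ↔ ∀ ε > 0, ∀ N, ∃ n ≥ N, dist (u n) y < ε := by
  simp only [Metric.nhds_basis_ball.mapClusterPt_iff_frequently, frequently_atTop,
    Metric.mem_ball]

lemma mapClusterPt_add_nat_iff {u : ℕ → X} {y : X} (k : ℕ) :
    MapClusterPt y atTop (fun n => u (n + k)) ↔ MapClusterPt y atTop u := by
  have h : map (fun n => u (n + k)) atTop = map u atTop := by
    conv_rhs => rw [← map_add_atTop_eq_nat k, map_map]
    rfl
  rw [MapClusterPt, MapClusterPt, h]

lemma isClosed_omegaLimitPt (f : X → X) (x : X) : IsClosed (omegaLimitPt f x) := by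
  have h : omegaLimitPt f x = {y | ClusterPt y (map (fun n => f^[n] x) atTop)} := by
    ext y
    exact mem_omegaLimitPt_iff
  rw [h]
  exact isClosed_setOfPred_clusterPt

lemma omegaLimitPt_nonempty [CompactSpace X] (f : X → X) (x : X) :
    (omegaLimitPt f x).Nonempty := by
  obtain ⟨y, hy⟩ := exists_clusterPt_of_compactSpace (map (fun n => f^[n] x) atTop)
  exact ⟨y, mem_omegaLimitPt_iff.2 hy⟩

lemma map_mem_omegaLimitPt {f : X → X} (hf : Continuous f) {x y : X}
    (hy : y ∈ omegaLimitPt f x) : f y ∈ omegaLimitPt f x := by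
  obtain ⟨φ, hφ, h⟩ := hy
  refine ⟨fun j => φ j + 1, fun a b hab => Nat.succ_lt_succ (hφ hab), ?_⟩
  simpa only [Function.iterate_succ_apply', Function.comp_def] using (hf.tendsto y).comp h

lemma iterate_mem_omegaLimitPt {f : X → X} (hf : Continuous f) {x y : X}
    (hy : y ∈ omegaLimitPt f x) (n : ℕ) : f^[n] y ∈ omegaLimitPt f x := by
  induction n with
  | zero => exact hy
  | succ n ih =>
    rw [Function.iterate_succ_apply']
    exact map_mem_omegaLimitPt hf ih

/-- Cluster points of a sequence are close to cluster points of any sequence that stays close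
to it. -/
lemma exists_mapClusterPt_dist_le [CompactSpace X] {u v : ℕ → X} {p : X} {ε : ℝ}
    (hp : MapClusterPt p atTop u) (h : ∀ i, dist (u i) (v i) ≤ ε) :
    ∃ q, MapClusterPt q atTop v ∧ dist p q ≤ ε := by
  obtain ⟨φ, hφ, hu⟩ := hp.tendsto_subseq
  obtain ⟨q, ψ, hψ, hv⟩ := CompactSpace.tendsto_subseq (v ∘ φ)
  refine ⟨q, MapClusterPt.of_comp (hφ.comp hψ).tendsto_atTop hv.mapClusterPt, ?_⟩
  exact le_of_tendsto ((hu.comp hψ.tendsto_atTop).dist hv) (Eventually.of_forall fun _ => h _)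

/-- The sequence following `c` up to time `k` and `u` afterwards. -/
def concatAt {Y : Type*} (k : ℕ) (c u : ℕ → Y) (i : ℕ) : Y := if i < k then c i else u (i - k)

lemma concatAt_add {Y : Type*} (k : ℕ) (c u : ℕ → Y) (i : ℕ) : concatAt k c u (i + k) = u i := by
  simp [concatAt]

lemma concatAt_zero {Y : Type*} {k : ℕ} (hk : 1 ≤ k) (c u : ℕ → Y) : concatAt k c u 0 = c 0 := by
  simp [concatAt, Nat.lt_of_succ_le hk]

lemma dist_concatAt_le {f : X → X} {δ : ℝ} {c u : ℕ → X} {k i : ℕ}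
    (hc : ∀ j < k, dist (f (c j)) (c (j + 1)) ≤ δ) (hcu : c k = u 0)
    (hu : k ≤ i → dist (f (u (i - k))) (u (i - k + 1)) ≤ δ) :
    dist (f (concatAt k c u i)) (concatAt k c u (i + 1)) ≤ δ := by
  unfold concatAt
  rcases lt_trichotomy (i + 1) k with h | h | h
  · rw [if_pos (by omega), if_pos h]
    exact hc i (by omega)
  · subst h
    rw [if_pos (by omega), if_neg (by omega), Nat.sub_self, ← hcu]
    exact hc i (by omega)
  · rw [if_neg (by omega), if_neg (by omega), Nat.sub_add_comm (by omega)]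
    exact hu (by omega)

lemma ChainReach.trans {f : X → X} {a b c : X} (hab : ChainReach f a b)
    (hbc : ChainReach f b c) : ChainReach f a c := by
  intro δ hδ
  obtain ⟨u, k, ⟨hk, hu⟩, hu0, huk⟩ := hab δ hδ
  obtain ⟨v, l, ⟨hl, hv⟩, hv0, hvl⟩ := hbc δ hδ
  refine ⟨concatAt k u v, l + k, ⟨by omega, fun i hi => ?_⟩, ?_, ?_⟩
  · exact dist_concatAt_le hu (huk.trans hv0.symm) fun _ => hv _ (by omega)
  · rw [concatAt_zero hk, hu0]
  · rw [concatAt_add, hvl]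

lemma chainReach_of_mem_omegaLimitPt {f : X → X} {x y : X} (hy : y ∈ omegaLimitPt f x) :
    ChainReach f x y := by
  intro δ hδ
  obtain ⟨n, hn, hd⟩ := mapClusterPt_atTop_iff.1 (mem_omegaLimitPt_iff.1 hy) δ hδ 1
  refine ⟨fun i => if i < n then f^[i] x else y, n, ⟨hn, fun i hi => ?_⟩, ?_, by simp⟩
  · simp only [if_pos hi]
    rw [← Function.iterate_succ_apply' f]
    split_ifs with h
    · simpa using hδ.le
    · obtain rfl : n = i + 1 := by omega
      exact hd.le
  · simp [Nat.lt_of_succ_le hn]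

/-- Upper semicontinuity at a shadowable point controls the cluster points of pseudo orbits. -/
lemma USCPoint.exists_dist_le [CompactSpace X] {f : X → X} {x : X} (hx : ShadowablePoint f x)
    (h : USCPoint f x) {ε : ℝ} (hε : 0 < ε) :
    ∃ δ > 0, ∀ xs : ℕ → X, (∀ i, dist (f (xs i)) (xs (i + 1)) ≤ δ) → xs 0 = x →
      ∀ p, MapClusterPt p atTop xs → ∃ q ∈ omegaLimitPt f x, dist p q < ε := by
  obtain ⟨η, hη, hU⟩ := h _ (Metric.isOpen_thickening (δ := ε / 2))
    (Metric.self_subset_thickening (half_pos hε) _)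
  obtain ⟨δ, hδ, hsh⟩ := hx (min η (ε / 2)) (lt_min hη (half_pos hε))
  refine ⟨δ, hδ, fun xs hxs h0 p hp => ?_⟩
  obtain ⟨y, hy⟩ := hsh xs hxs h0
  have hxy : dist x y ≤ η := by simpa [h0] using (hy 0).trans (min_le_left _ _)
  obtain ⟨r, hr, hpr⟩ := exists_mapClusterPt_dist_le hp fun i => (hy i).trans (min_le_right _ _)
  obtain ⟨q, hq, hrq⟩ := Metric.mem_thickening_iff.1 (hU y hxy (mem_omegaLimitPt_iff.2 hr))
  exact ⟨q, hq, by linarith [dist_triangle p r q]⟩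

/-- Lower semicontinuity at a shadowable point yields cluster points of pseudo orbits. -/
lemma LSCPoint.exists_dist_le [CompactSpace X] {f : X → X} {x : X} (hx : ShadowablePoint f x)
    (h : LSCPoint f x) {p : X} (hp : p ∈ omegaLimitPt f x) {ε : ℝ} (hε : 0 < ε) :
    ∃ δ > 0, ∀ xs : ℕ → X, (∀ i, dist (f (xs i)) (xs (i + 1)) ≤ δ) → xs 0 = x →
      ∃ q, MapClusterPt q atTop xs ∧ dist p q < ε := by
  obtain ⟨η, hη, hU⟩ := h _ Metric.isOpen_ball ⟨p, hp, Metric.mem_ball_self (half_pos hε)⟩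
  obtain ⟨δ, hδ, hsh⟩ := hx (min η (ε / 2)) (lt_min hη (half_pos hε))
  refine ⟨δ, hδ, fun xs hxs h0 => ?_⟩
  obtain ⟨y, hy⟩ := hsh xs hxs h0
  have hxy : dist x y ≤ η := by simpa [h0] using (hy 0).trans (min_le_left _ _)
  obtain ⟨r, hr, hrp⟩ := hU y hxy
  obtain ⟨q, hq, hrq⟩ := exists_mapClusterPt_dist_le (mem_omegaLimitPt_iff.1 hr)
    fun i => (dist_comm _ _).trans_le ((hy i).trans (min_le_right _ _))
  rw [Metric.mem_ball, dist_comm] at hrp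
  exact ⟨q, hq, by linarith [dist_triangle p r q]⟩

lemma ChainReach.exists_pseudoOrbit_iterate {f : X → X} {x z : X} (h : ChainReach f x z)
    {δ : ℝ} (hδ : 0 < δ) :
    ∃ xs : ℕ → X, (∀ i, dist (f (xs i)) (xs (i + 1)) ≤ δ) ∧ xs 0 = x ∧
      ∀ p, MapClusterPt p atTop xs ↔ p ∈ omegaLimitPt f z := by
  obtain ⟨c, k, ⟨hk, hc⟩, hc0, hck⟩ := h δ hδ
  refine ⟨concatAt k c fun i => f^[i] z, fun i => dist_concatAt_le hc hck fun _ => ?_, ?_,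
    fun p => ?_⟩
  · rw [← Function.iterate_succ_apply' f, dist_self]
    exact hδ.le
  · rw [concatAt_zero hk, hc0]
  · rw [← mapClusterPt_add_nat_iff k, mem_omegaLimitPt_iff]
    simp only [concatAt_add]

lemma ChainReach.exists_pseudoOrbit_recurrent {f : X → X} {x z : X} (h : ChainReach f x z)
    (hz : ChainReach f z z) {δ : ℝ} (hδ : 0 < δ) :
    ∃ xs : ℕ → X, (∀ i, dist (f (xs i)) (xs (i + 1)) ≤ δ) ∧ xs 0 = x ∧
      MapClusterPt z atTop xs := by
  obtain ⟨c, k, ⟨hk, hc⟩, hc0, hck⟩ := h δ hδ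
  obtain ⟨e, l, ⟨hl, he⟩, he0, hel⟩ := hz δ hδ
  refine ⟨concatAt k c fun i => e (i % l), fun i => dist_concatAt_le hc ?_ fun _ => ?_, ?_, ?_⟩
  · rw [hck, Nat.zero_mod, he0]
  · have hlt : (i - k) % l < l := Nat.mod_lt _ (by omega)
    have hstep := he _ hlt
    rw [← Nat.mod_add_mod (i - k) l 1]
    rcases Nat.lt_or_ge ((i - k) % l + 1) l with h' | h'
    · rwa [Nat.mod_eq_of_lt h']
    · have heq : (i - k) % l + 1 = l := by omega
      rw [heq, hel] at hstep
      rwa [heq, Nat.mod_self, he0]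
  · rw [concatAt_zero hk, hc0]
  · rw [← mapClusterPt_add_nat_iff k]
    simp only [concatAt_add]
    refine mapClusterPt_atTop_iff.2 fun ε hε N => ⟨N * l, Nat.le_mul_of_pos_right N hl, ?_⟩
    simpa [he0] using hε

/-- At a shadowable continuity point `x`, all points chain reachable from `x` have the same
ω-limit set as `x`. -/
lemma ShadowablePoint.omegaLimitPt_eq [CompactSpace X] {f : X → X} {x z : X}
    (hx : ShadowablePoint f x) (hu : USCPoint f x) (hl : LSCPoint f x) (h : ChainReach f x z) :
    omegaLimitPt f z = omegaLimitPt f x := by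
  apply Set.Subset.antisymm
  · intro p hp
    rw [← (isClosed_omegaLimitPt f x).closure_eq, Metric.mem_closure_iff]
    intro ε hε
    obtain ⟨δ, hδ, hxs⟩ := hu.exists_dist_le hx hε
    obtain ⟨xs, h1, h0, hcl⟩ := h.exists_pseudoOrbit_iterate hδ
    exact hxs xs h1 h0 p ((hcl p).2 hp)
  · intro p hp
    rw [← (isClosed_omegaLimitPt f z).closure_eq, Metric.mem_closure_iff]
    intro ε hε
    obtain ⟨δ, hδ, hxs⟩ := hl.exists_dist_le hx hp hε
    obtain ⟨xs, h1, h0, hcl⟩ := h.exists_pseudoOrbit_iterate hδ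
    obtain ⟨q, hq, hpq⟩ := hxs xs h1 h0
    exact ⟨q, (hcl q).1 hq, hpq⟩

/-- At a shadowable upper semicontinuity point `x`, chain recurrent points that are chain
reachable from `x` are ω-limit points of `x`. -/
lemma ShadowablePoint.mem_omegaLimitPt [CompactSpace X] {f : X → X} {x z : X}
    (hx : ShadowablePoint f x) (hu : USCPoint f x) (h : ChainReach f x z)
    (hz : ChainReach f z z) : z ∈ omegaLimitPt f x := by
  rw [← (isClosed_omegaLimitPt f x).closure_eq, Metric.mem_closure_iff]
  intro ε hε
  obtain ⟨δ, hδ, hxs⟩ := hu.exists_dist_le hx hε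
  obtain ⟨xs, h1, h0, hcl⟩ := h.exists_pseudoOrbit_recurrent hz hδ
  exact hxs xs h1 h0 z hcl

/-- An ω-limit point of `x` chain reaches every limit of ω-limit points of points tending
to `x`. -/
lemma chainReach_of_tendsto {f : X → X} (hf : Continuous f) {x q p : X} {ys ps : ℕ → X}
    (hq : q ∈ omegaLimitPt f x) (hys : Tendsto ys atTop (𝓝 x))
    (hps : ∀ n, ps n ∈ omegaLimitPt f (ys n)) (hp : Tendsto ps atTop (𝓝 p)) :
    ChainReach f q p := by
  intro δ hδ
  obtain ⟨m, -, hm⟩ := mapClusterPt_atTop_iff.1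
    (mem_omegaLimitPt_iff.1 (map_mem_omegaLimitPt hf hq)) (δ / 2) (half_pos hδ) 0
  have hev : ∀ᶠ n in atTop, dist (f^[m] (ys n)) (f^[m] x) < δ / 2 :=
    (((hf.iterate m).tendsto x).comp hys).eventually (Metric.ball_mem_nhds _ (half_pos hδ))
  obtain ⟨n, hn, hpn⟩ :=
    (hev.and (hp.eventually (Metric.ball_mem_nhds p (half_pos hδ)))).exists
  obtain ⟨k, hk, hkd⟩ := mapClusterPt_atTop_iff.1 (mem_omegaLimitPt_iff.1 (hps n)) (δ / 2)
    (half_pos hδ) (m + 1)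
  obtain ⟨l, rfl⟩ := Nat.exists_eq_add_of_le hk
  refine ⟨fun i => if i = 0 then q else if i < l + 2 then f^[m + (i - 1)] (ys n) else p, l + 2,
    ⟨by omega, fun i hi => ?_⟩, by simp, by simp⟩
  rcases i with _ | i
  · simp only [if_true, zero_add, one_ne_zero, if_false, Nat.sub_self, add_zero]
    rw [if_pos (by omega), dist_comm]
    linarith [dist_triangle (f^[m] (ys n)) (f^[m] x) (f q)]
  · simp only [Nat.add_eq_zero_iff, one_ne_zero, and_false, if_false, if_pos hi,
      Nat.add_sub_cancel]
    rw [← Function.iterate_succ_apply' f]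
    split_ifs with h
    · simpa [add_assoc] using hδ.le
    · obtain rfl : i = l := by omega
      rw [show (m + i).succ = m + 1 + i by omega]
      linarith [dist_triangle (f^[m + 1 + i] (ys n)) (ps n) p]

lemma ChainStable.uscPoint [CompactSpace X] {f : X → X} (hf : Continuous f) {x : X}
    (h : ChainStable f (omegaLimitPt f x)) : USCPoint f x := by
  intro U hU hsub
  by_contra! hcon
  have hex : ∀ n : ℕ, ∃ y p, dist x y ≤ 1 / ((n : ℝ) + 1) ∧ p ∈ omegaLimitPt f y ∧ p ∉ U := by
    intro n
    obtain ⟨y, hy, hny⟩ := hcon (1 / ((n : ℝ) + 1)) (by positivity)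
    obtain ⟨p, hp, hpU⟩ := Set.not_subset.1 hny
    exact ⟨y, p, hy, hp, hpU⟩
  choose ys ps hd hps hpU using hex
  have hys : Tendsto ys atTop (𝓝 x) := by
    rw [tendsto_iff_dist_tendsto_zero]
    exact squeeze_zero (fun _ => dist_nonneg) (fun n => (dist_comm _ _).trans_le (hd n))
      tendsto_one_div_add_atTop_nhds_zero_nat
  obtain ⟨p, φ, hφ, hp⟩ := CompactSpace.tendsto_subseq ps
  obtain ⟨q, hq⟩ := omegaLimitPt_nonempty f x
  have hpω := h q hq p (chainReach_of_tendsto hf hq (hys.comp hφ.tendsto_atTop)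
    (fun n => hps (φ n)) hp)
  exact hU.isClosed_compl.mem_of_tendsto hp (Eventually.of_forall fun n => hpU (φ n)) (hsub hpω)

lemma USCPoint.lscPoint_of_isMinimalSet [CompactSpace X] {f : X → X} (hf : Continuous f) {x : X}
    (h : USCPoint f x) (hmin : IsMinimalSet f (omegaLimitPt f x)) : LSCPoint f x := by
  rintro U hU ⟨p, hp, hpU⟩
  obtain ⟨δ, hδ, hsub⟩ := h (⋃ n, f^[n] ⁻¹' U)
    (isOpen_iUnion fun n => hU.preimage (hf.iterate n)) fun q hq => by
      obtain ⟨φ, -, hφ⟩ := (hmin.2.2.2 q hq).symm ▸ hp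
      obtain ⟨j, hj⟩ := (hφ.eventually (hU.mem_nhds hpU)).exists
      exact Set.mem_iUnion.2 ⟨φ j, hj⟩
  refine ⟨δ, hδ, fun y hy => ?_⟩
  obtain ⟨q, hq⟩ := omegaLimitPt_nonempty f y
  obtain ⟨n, hn⟩ := Set.mem_iUnion.1 (hsub y hy hq)
  exact ⟨f^[n] q, iterate_mem_omegaLimitPt hf hq n, hn⟩

theorem stmt9 [CompactSpace X] (f : X → X) (hf : Continuous f) (x : X)
    (hx : ShadowablePoint f x) :
    (USCPoint f x ∧ LSCPoint f x) ↔
      (ChainStable f (omegaLimitPt f x) ∧ IsMinimalSet f (omegaLimitPt f x)) := by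
  constructor
  · rintro ⟨hu, hl⟩
    refine ⟨fun y hy z hyz => ?_, omegaLimitPt_nonempty f x, isClosed_omegaLimitPt f x,
      Set.image_subset_iff.2 fun y hy => map_mem_omegaLimitPt hf hy,
      fun y hy => hx.omegaLimitPt_eq hu hl (chainReach_of_mem_omegaLimitPt hy)⟩
    have hxz : ChainReach f x z := (chainReach_of_mem_omegaLimitPt hy).trans hyz
    rw [← hx.omegaLimitPt_eq hu hl hxz] at hy
    exact hx.mem_omegaLimitPt hu hxz ((chainReach_of_mem_omegaLimitPt hy).trans hyz)
  · rintro ⟨hs, hmin⟩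
    exact ⟨hs.uscPoint hf, (hs.uscPoint hf).lscPoint_of_isMinimalSet hf hmin⟩
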